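/- arXiv:2101.10415 — 11 statements merged into one kernel-verified Lean document; each statement's English description precedes it below -/
import Mathlib

section
/- Let k ≥ 3 be an integer with k ≠ 4. Then there are infinitely many odd perfect squares having exactly k non-zero digits in their binary representation; i.e., the set of natural numbers n such that n is odd, n is a perfect square, and n has exactly k non-zero digits in base 2 is infinite. -/
/-- The number of non-zero binary digits of `n`. -/
def binaryWeight (n : ℕ) : ℕ := ((Nat.digits 2 n).filter (· ≠ 0)).length

@[simp]
lemma binaryWeight_zero : binaryWeight 0 = 0 := by simp [binaryWeight]

@[simp]
lemma binaryWeight_two_mul_add_one (n : ℕ) :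
    binaryWeight (2 * n + 1) = binaryWeight n + 1 := by
  unfold binaryWeight
  rw [add_comm (2 * n) 1, Nat.digits_add 2 one_lt_two 1 n one_lt_two (Or.inl one_ne_zero)]
  simp

@[simp]
lemma binaryWeight_two_mul (n : ℕ) : binaryWeight (2 * n) = binaryWeight n := by
  rcases Nat.eq_zero_or_pos n with rfl | hn
  · simp
  · unfold binaryWeight
    rw [Nat.digits_base_mul one_lt_two hn]
    simp

@[simp]
lemma binaryWeight_one : binaryWeight 1 = 1 := by simp [binaryWeight]

/-- Binary blocks that do not overlap contribute independently to the weight. -/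
lemma binaryWeight_two_pow_mul_add (N a b : ℕ) (ha : a < 2 ^ N) :
    binaryWeight (2 ^ N * b + a) = binaryWeight b + binaryWeight a := by
  induction N generalizing a with
  | zero =>
    obtain rfl : a = 0 := by simpa using ha
    simp
  | succ N ih =>
    rw [pow_succ] at ha
    obtain ⟨c, rfl | rfl⟩ := a.even_or_odd'
    · rw [show 2 ^ (N + 1) * b + 2 * c = 2 * (2 ^ N * b + c) by ring, binaryWeight_two_mul,
        binaryWeight_two_mul, ih c (by omega)]
    · rw [show 2 ^ (N + 1) * b + (2 * c + 1) = 2 * (2 ^ N * b + c) + 1 by ring,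
        binaryWeight_two_mul_add_one, binaryWeight_two_mul_add_one, ih c (by omega), add_assoc]

lemma exists_add_one_eq_two_pow_and_binaryWeight_eq (t : ℕ) :
    ∃ c, c + 1 = 2 ^ t ∧ binaryWeight c = t := by
  induction t with
  | zero => exact ⟨0, by simp⟩
  | succ t ih =>
    obtain ⟨c, hc, hw⟩ := ih
    exact ⟨2 * c + 1, by rw [pow_succ]; omega, by simp [hw]⟩

/-- The squares of `2 ^ N + a`, for `a` odd and `N` large, all have the same weight. -/
lemma infinite_odd_squares_of_odd {a : ℕ} (ha : Odd a) :
    {n : ℕ | Odd n ∧ (∃ m : ℕ, n = m ^ 2) ∧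
      binaryWeight n = binaryWeight (a ^ 2) + binaryWeight a + 1}.Infinite := by
  refine Set.infinite_of_forall_exists_gt fun n => ?_
  have hM : a ^ 2 + n < 2 ^ (a ^ 2 + n) := Nat.lt_two_pow_self
  set M := a ^ 2 + n
  have haa : a ≤ a ^ 2 := Nat.le_self_pow two_ne_zero a
  have hodd : Odd (2 ^ (M + 1) + a) := (even_two.pow_of_ne_zero M.succ_ne_zero).add_odd ha
  refine ⟨(2 ^ (M + 1) + a) ^ 2, ⟨hodd.pow, ⟨_, rfl⟩, ?_⟩, ?_⟩
  · rw [show (2 ^ (M + 1) + a) ^ 2 = 2 ^ (M + 2) * (2 ^ M * 1 + a) + a ^ 2 by ring,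
      binaryWeight_two_pow_mul_add _ _ _ (by rw [pow_add]; omega),
      binaryWeight_two_pow_mul_add _ _ _ (by omega), binaryWeight_one]
    ring
  · have : 2 ^ (M + 1) + a ≤ (2 ^ (M + 1) + a) ^ 2 := Nat.le_self_pow two_ne_zero _
    have : 2 ^ (M + 1) = 2 ^ M * 2 := pow_succ 2 M
    omega

/-- `a = 2 ^ (u + 1) - 1` satisfies the claim. -/
lemma exists_odd_binaryWeight_add_eq_even (u : ℕ) :
    ∃ a, Odd a ∧ binaryWeight (a ^ 2) + binaryWeight a = 2 * u + 2 := by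
  obtain ⟨d, hd, hw⟩ := exists_add_one_eq_two_pow_and_binaryWeight_eq u
  refine ⟨2 * d + 1, odd_two_mul_add_one d, ?_⟩
  have hsq : (2 * d + 1) ^ 2 = 2 ^ (u + 2) * d + 1 := by
    rw [pow_add, ← hd]
    ring
  rw [hsq, binaryWeight_two_pow_mul_add _ _ _ (Nat.one_lt_two_pow (by omega)),
    binaryWeight_two_mul_add_one, hw, binaryWeight_one]
  ring

/-- `a = 2 ^ (u + 3) - 3` satisfies the claim. -/
lemma exists_odd_binaryWeight_add_eq_odd (u : ℕ) :
    ∃ a, Odd a ∧ binaryWeight (a ^ 2) + binaryWeight a = 2 * u + 5 := by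
  obtain ⟨d, hd, hw⟩ := exists_add_one_eq_two_pow_and_binaryWeight_eq u
  refine ⟨2 * (2 * (2 * d + 1)) + 1, odd_two_mul_add_one _, ?_⟩
  have hsq : (2 * (2 * (2 * d + 1)) + 1) ^ 2 = 2 ^ (u + 4) * (2 * (2 * d) + 1) + 9 := by
    rw [pow_add, ← hd]
    ring
  have hnine : binaryWeight 9 = 2 := by simp [binaryWeight]
  have hlt : 9 < 2 ^ (u + 4) := by rw [pow_add]; omega
  rw [hsq, binaryWeight_two_pow_mul_add _ _ _ hlt, hnine]
  simp only [binaryWeight_two_mul_add_one, binaryWeight_two_mul, hw]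
  ring

theorem infinitely_many_odd_squares_with_k_binary_digits
    (k : ℕ) (hk : 3 ≤ k) (hk4 : k ≠ 4) :
    {n : ℕ | Odd n ∧ (∃ m : ℕ, n = m ^ 2) ∧
      ((Nat.digits 2 n).filter (· ≠ 0)).length = k}.Infinite := by
  obtain ⟨a, ha, hw⟩ : ∃ a, Odd a ∧ binaryWeight (a ^ 2) + binaryWeight a + 1 = k := by
    obtain ⟨c, rfl | rfl⟩ := k.even_or_odd'
    · obtain ⟨a, ha, hw⟩ := exists_odd_binaryWeight_add_eq_odd (c - 3)
      exact ⟨a, ha, by omega⟩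
    · obtain ⟨a, ha, hw⟩ := exists_odd_binaryWeight_add_eq_even (c - 1)
      exact ⟨a, ha, by omega⟩
  rw [← hw]
  exact infinite_odd_squares_of_odd ha
end

section
/- Let k be a positive integer greater than 4 that is not of the form p(p−1)/2 + 1 for any positive integer p. Then there exist infinitely many odd perfect squares having exactly k non-zero digits in their binary representation. -/
namespace binaryWeight

lemma two_mul (n : ℕ) : binaryWeight (2 * n) = binaryWeight n := by
  rcases Nat.eq_zero_or_pos n with rfl | hn
  · rfl
  · have h := Nat.digits_add 2 (by norm_num) 0 n (by norm_num) (Or.inr hn.ne')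
    rw [zero_add] at h
    simp [binaryWeight, h]

lemma two_mul_add_one (n : ℕ) : binaryWeight (2 * n + 1) = binaryWeight n + 1 := by
  have h := Nat.digits_add 2 (by norm_num) 1 n (by norm_num) (Or.inl one_ne_zero)
  rw [add_comm] at h
  rw [binaryWeight, h]
  simp [binaryWeight]

@[simp] lemma zero : binaryWeight 0 = 0 := by simp [binaryWeight]

@[simp] lemma one : binaryWeight 1 = 1 := by simp [binaryWeight]

@[simp] lemma nine : binaryWeight 9 = 2 := by simp [binaryWeight]

lemma add_two_pow_mul (N b : ℕ) {a : ℕ} (ha : a < 2 ^ N) :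
    binaryWeight (a + 2 ^ N * b) = binaryWeight a + binaryWeight b := by
  induction N generalizing a with
  | zero =>
    obtain rfl : a = 0 := by simpa using ha
    simp
  | succ N ih =>
    rw [pow_succ] at ha
    rcases Nat.even_or_odd' a with ⟨c, rfl | rfl⟩
    · rw [show 2 * c + 2 ^ (N + 1) * b = 2 * (c + 2 ^ N * b) by ring, two_mul, two_mul,
        ih (by omega)]
    · rw [show 2 * c + 1 + 2 ^ (N + 1) * b = 2 * (c + 2 ^ N * b) + 1 by ring,
        two_mul_add_one, two_mul_add_one, ih (by omega)]
      ring

lemma two_pow_sub_one (n : ℕ) : binaryWeight (2 ^ n - 1) = n := by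
  induction n with
  | zero => simp
  | succ n ih =>
    have h := Nat.one_le_two_pow (n := n)
    rw [show 2 ^ (n + 1) - 1 = 2 * (2 ^ n - 1) + 1 by rw [pow_succ]; omega, two_mul_add_one, ih]

lemma two_pow_sub_three (n : ℕ) : binaryWeight (2 ^ (n + 2) - 3) = n + 1 := by
  have h := Nat.one_le_two_pow (n := n)
  rw [show 2 ^ (n + 2) - 3 = 1 + 2 ^ 2 * (2 ^ n - 1) by rw [pow_add]; omega,
    add_two_pow_mul 2 _ (by norm_num), two_pow_sub_one, one, add_comm]

lemma two_pow_sub_one_sq (n : ℕ) : binaryWeight ((2 ^ (n + 1) - 1) ^ 2) = n + 1 := by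
  obtain ⟨c, hc⟩ := Nat.exists_eq_add_of_le (Nat.one_le_two_pow (n := n))
  have h : (2 ^ (n + 1) - 1) ^ 2 = 1 + 2 ^ (n + 2) * (2 ^ n - 1) := by
    rw [pow_add, pow_add, hc, show (1 + c) * 2 ^ 1 - 1 = 2 * c + 1 by omega, Nat.add_sub_cancel_left]
    ring
  rw [h, add_two_pow_mul _ _ (Nat.one_lt_two_pow (by omega)), two_pow_sub_one, one, add_comm]

lemma two_pow_sub_three_sq (n : ℕ) : binaryWeight ((2 ^ (n + 3) - 3) ^ 2) = n + 3 := by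
  obtain ⟨c, hc⟩ := Nat.exists_eq_add_of_le (Nat.one_le_two_pow (n := n))
  have h : (2 ^ (n + 3) - 3) ^ 2 = 9 + 2 ^ (n + 4) * (2 ^ (n + 2) - 3) := by
    rw [pow_add, pow_add, pow_add, hc, show (1 + c) * 2 ^ 3 - 3 = 8 * c + 5 by omega,
      show (1 + c) * 2 ^ 2 - 3 = 4 * c + 1 by omega]
    ring
  have h9 : 9 < 2 ^ (n + 4) := by rw [pow_add, hc]; omega
  rw [h, add_two_pow_mul _ _ h9, two_pow_sub_three, nine]
  ring

/-- Adding a large power of two to `s` and squaring produces three non-overlapping blocks. -/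
lemma two_pow_add_sq {N s : ℕ} (hs : s ^ 2 < 2 ^ (N + 1)) (hs' : s < 2 ^ (N - 1)) (hN : 1 ≤ N) :
    binaryWeight ((2 ^ N + s) ^ 2) = binaryWeight (s ^ 2) + binaryWeight s + 1 := by
  obtain ⟨M, rfl⟩ := Nat.exists_eq_add_of_le' hN
  rw [Nat.add_sub_cancel] at hs'
  have h : (2 ^ (M + 1) + s) ^ 2 = s ^ 2 + 2 ^ (M + 1 + 1) * (s + 2 ^ M * 1) := by ring
  rw [h, add_two_pow_mul _ _ hs, add_two_pow_mul _ _ hs', one, add_assoc]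

end binaryWeight

lemma infinite_odd_squares_of_binaryWeight {s : ℕ} (hs : Odd s) :
    {n : ℕ | Odd n ∧ (∃ m : ℕ, n = m ^ 2) ∧
      binaryWeight n = binaryWeight (s ^ 2) + binaryWeight s + 1}.Infinite := by
  refine Set.infinite_of_injective_forall_mem (f := fun i : ℕ => (2 ^ (i + s ^ 2 + 1) + s) ^ 2)
    ?_ fun i => ⟨?_, ⟨_, rfl⟩, ?_⟩
  · intro i j h
    have h₁ := Nat.add_right_cancel (Nat.pow_left_injective two_ne_zero h)
    have h₂ := Nat.pow_right_injective le_rfl h₁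
    omega
  · exact (Even.add_odd (by simp [pow_succ]) hs).pow
  · have h : s ^ 2 < 2 ^ (i + s ^ 2) :=
      Nat.lt_two_pow_self.trans_le (Nat.pow_le_pow_right two_pos (by omega))
    refine binaryWeight.two_pow_add_sq (h.trans_le (Nat.pow_le_pow_right two_pos (by omega))) ?_
      (by omega)
    rw [Nat.add_sub_cancel]
    exact (Nat.le_self_pow two_ne_zero s).trans_lt h

theorem infinitely_many_odd_squares_binary_not_triangular_form
    (k : ℕ) (hk : 4 < k)
    (hform : ¬ ∃ p : ℕ, 0 < p ∧ k = p * (p - 1) / 2 + 1) :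
    {n : ℕ | Odd n ∧ (∃ m : ℕ, n = m ^ 2) ∧
      ((Nat.digits 2 n).filter (· ≠ 0)).length = k}.Infinite := by
  change {n : ℕ | Odd n ∧ (∃ m : ℕ, n = m ^ 2) ∧ binaryWeight n = k}.Infinite
  rcases Nat.even_or_odd' k with ⟨c, rfl | rfl⟩
  · obtain ⟨j, rfl⟩ := Nat.exists_eq_add_of_le' (show 3 ≤ c by omega)
    have hodd : Odd (2 ^ (j + 3) - 3) := by
      have h := Nat.one_le_two_pow (n := j)
      rw [Nat.odd_iff, pow_add]
      omega
    have h := infinite_odd_squares_of_binaryWeight hodd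
    rwa [binaryWeight.two_pow_sub_three_sq, binaryWeight.two_pow_sub_three (j + 1),
      show j + 3 + (j + 1 + 1) + 1 = 2 * (j + 3) by ring] at h
  · obtain ⟨j, rfl⟩ := Nat.exists_eq_add_of_le' (show 1 ≤ c by omega)
    have hodd : Odd (2 ^ (j + 1) - 1) := by
      have h := Nat.one_le_two_pow (n := j)
      rw [Nat.odd_iff, pow_succ]
      omega
    have h := infinite_odd_squares_of_binaryWeight hodd
    rwa [binaryWeight.two_pow_sub_one_sq, binaryWeight.two_pow_sub_one,
      show j + 1 + (j + 1) + 1 = 2 * (j + 1) + 1 by ring] at h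
end

section
/- For every integer a ≥ 4, the identity (1 + 2^a + 2^{a+1} + 2^{a+2})² = 1 + 2^{a+1} + 2^{a+2} + 2^{a+3} + 2^{2a} + 2^{2a+4} + 2^{2a+5} holds, and consequently the perfect square (1 + 2^a + 2^{a+1} + 2^{a+2})² has exactly 7 non-zero digits in its binary representation. -/
/-- Prepending a non-zero digit `d`, followed by `k` zeros, to the base-`b` expansion of `n`
increases the number of non-zero digits by one. -/
theorem Nat.length_filter_digits_add_base_pow_succ_mul {b d : ℕ} (hb : 1 < b) (hd : d ≠ 0)
    (hdb : d < b) (k n : ℕ) :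
    ((Nat.digits b (d + b ^ (k + 1) * n)).filter (· ≠ 0)).length
      = ((Nat.digits b n).filter (· ≠ 0)).length + 1 := by
  rw [show d + b ^ (k + 1) * n = d + b * (b ^ k * n) by ring,
    Nat.digits_add b hb d _ hdb (Or.inl hd)]
  rcases Nat.eq_zero_or_pos n with rfl | hn
  · simp [hd]
  · simp [Nat.digits_base_pow_mul hb hn, hd]

theorem square_of_four_term_sum_binary
    (a : ℕ) (ha : 4 ≤ a) :
    (1 + 2 ^ a + 2 ^ (a + 1) + 2 ^ (a + 2)) ^ 2
      = 1 + 2 ^ (a + 1) + 2 ^ (a + 2) + 2 ^ (a + 3) + 2 ^ (2 * a)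
          + 2 ^ (2 * a + 4) + 2 ^ (2 * a + 5) ∧
    ((Nat.digits 2 ((1 + 2 ^ a + 2 ^ (a + 1) + 2 ^ (a + 2)) ^ 2)).filter
      (· ≠ 0)).length = 7 := by
  refine ⟨by ring, ?_⟩
  obtain ⟨b, rfl⟩ := Nat.exists_eq_add_of_le' ha
  have horner : (1 + 2 ^ (b + 4) + 2 ^ (b + 4 + 1) + 2 ^ (b + 4 + 2)) ^ 2
      = 1 + 2 ^ (b + 4 + 1) * (1 + 2 ^ (0 + 1) * (1 + 2 ^ (0 + 1) * (1 + 2 ^ (b + 1) * 49))) := by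
    ring
  have step := Nat.length_filter_digits_add_base_pow_succ_mul one_lt_two one_ne_zero one_lt_two
  rw [horner, step, step, step, step]
  norm_num
end

section
/- Let x ≥ 2 and k ≥ 3 be integers with (x, k) ≠ (2, 4). Then there exist infinitely many perfect powers not divisible by x having exactly k non-zero digits in their base-x representation; i.e., the set of natural numbers n such that x does not divide n, n = y^d for some integers y ≥ 2 and d ≥ 2, and n has exactly k non-zero digits in base x, is infinite. -/
/-- The number of non-zero digits of `n` in base `x`. -/
def numNonzeroDigits (x n : ℕ) : ℕ := ((Nat.digits x n).filter (· ≠ 0)).length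

section

variable {x : ℕ}

@[simp]
lemma numNonzeroDigits_zero : numNonzeroDigits x 0 = 0 := by simp [numNonzeroDigits]

lemma numNonzeroDigits_mul_add (hx : 2 ≤ x) (q : ℕ) {r : ℕ} (hr : r < x) :
    numNonzeroDigits x (q * x + r) = numNonzeroDigits x q + if r = 0 then 0 else 1 := by
  rcases Nat.eq_zero_or_pos (q * x + r) with h | h
  · have hr0 : r = 0 := by omega
    have hq0 : q = 0 := by
      rcases Nat.mul_eq_zero.mp (show q * x = 0 by omega) with h | h <;> omega
    simp [hr0, hq0]
  · unfold numNonzeroDigits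
    have hmod : (q * x + r) % x = r := by
      rw [Nat.mul_comm, Nat.mul_add_mod, Nat.mod_eq_of_lt hr]
    have hdiv : (q * x + r) / x = q := by
      rw [Nat.mul_comm, Nat.mul_add_div (by omega), Nat.div_eq_of_lt hr, add_zero]
    rw [Nat.digits_def' (by omega) h, hmod, hdiv]
    by_cases hr0 : r = 0 <;> simp [hr0]

lemma numNonzeroDigits_digit (hx : 2 ≤ x) {r : ℕ} (h0 : 0 < r) (hr : r < x) :
    numNonzeroDigits x r = 1 := by
  simpa [h0.ne'] using numNonzeroDigits_mul_add hx 0 hr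

lemma numNonzeroDigits_mul_add_digit (hx : 2 ≤ x) (q : ℕ) {r : ℕ} (h0 : 0 < r) (hr : r < x) :
    numNonzeroDigits x (q * x + r) = numNonzeroDigits x q + 1 := by
  simpa [h0.ne'] using numNonzeroDigits_mul_add hx q hr

lemma numNonzeroDigits_mul_base (hx : 2 ≤ x) (q : ℕ) :
    numNonzeroDigits x (q * x) = numNonzeroDigits x q := by
  simpa using numNonzeroDigits_mul_add hx q (r := 0) (by omega)

lemma numNonzeroDigits_mul_pow_add (hx : 2 ≤ x) (q e : ℕ) {r : ℕ} (hr : r < x ^ e) :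
    numNonzeroDigits x (q * x ^ e + r) = numNonzeroDigits x q + numNonzeroDigits x r := by
  induction e generalizing r with
  | zero =>
    obtain rfl : r = 0 := by simpa using hr
    simp
  | succ e ih =>
    have hlt : r % x < x := Nat.mod_lt _ (by omega)
    have hdiv : r / x < x ^ e := Nat.div_lt_of_lt_mul (by rwa [pow_succ'] at hr)
    have hr' : r = r / x * x + r % x := (Nat.div_add_mod' r x).symm
    have key : q * x ^ (e + 1) + r = (q * x ^ e + r / x) * x + r % x := by
      conv_lhs => rw [hr']
      ring
    rw [key, numNonzeroDigits_mul_add hx _ hlt, ih hdiv, add_assoc,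
      ← numNonzeroDigits_mul_add hx _ hlt, ← hr']

lemma numNonzeroDigits_pow_sub_one (hx : 2 ≤ x) (m : ℕ) :
    numNonzeroDigits x (x ^ m - 1) = m := by
  induction m with
  | zero => simp
  | succ m ih =>
    have hpos : 1 ≤ x ^ m := Nat.one_le_pow _ _ (by omega)
    have key : x ^ (m + 1) - 1 = (x ^ m - 1) * x + (x - 1) := by
      obtain ⟨t, ht⟩ := Nat.exists_eq_add_of_le hpos
      rw [pow_succ, ht, Nat.add_sub_cancel_left, add_mul]
      omega
    rw [key, numNonzeroDigits_mul_add_digit hx _ (by omega) (by omega), ih]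

lemma numNonzeroDigits_pow_succ_sub (hx : 2 ≤ x) (m : ℕ) {d : ℕ} (h0 : 0 < d) (hd : d < x) :
    numNonzeroDigits x (x ^ (m + 1) - d) = m + 1 := by
  have hpos : 1 ≤ x ^ m := Nat.one_le_pow _ _ (by omega)
  have key : x ^ (m + 1) - d = (x ^ m - 1) * x + (x - d) := by
    obtain ⟨t, ht⟩ := Nat.exists_eq_add_of_le hpos
    rw [pow_succ, ht, Nat.add_sub_cancel_left, add_mul]
    omega
  rw [key, numNonzeroDigits_mul_add_digit hx _ (by omega) (by omega),
    numNonzeroDigits_pow_sub_one hx]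

/-- The perfect powers not divisible by `x` with exactly `k` non-zero digits in base `x`. -/
def perfectPowersWithDigits (x k : ℕ) : Set ℕ :=
  {n : ℕ | ¬ x ∣ n ∧ (∃ y d : ℕ, 2 ≤ y ∧ 2 ≤ d ∧ n = y ^ d) ∧ numNonzeroDigits x n = k}

/-- The squares of `b * x ^ a + c`, for large `a`, all have the same number of non-zero digits. -/
lemma infinite_of_numNonzeroDigits_sq (hx : 2 ≤ x) {k b c : ℕ} (hb : 0 < b) (hc : ¬ x ∣ c ^ 2)
    (h : numNonzeroDigits x (b ^ 2) + numNonzeroDigits x (2 * b * c) +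
      numNonzeroDigits x (c ^ 2) = k) : (perfectPowersWithDigits x k).Infinite := by
  have hc0 : 0 < c := by
    rcases Nat.eq_zero_or_pos c with rfl | h
    · simp at hc
    · exact h
  have hcc : 0 < c ^ 2 := by positivity
  let f : ℕ → ℕ := fun a ↦ (b * x ^ (c ^ 2 + 2 * b * c + a) + c) ^ 2
  refine Set.infinite_of_injective_forall_mem (f := f) ?_ ?_
  · refine StrictMono.injective fun a a' haa' ↦ ?_
    have : x ^ (c ^ 2 + 2 * b * c + a) < x ^ (c ^ 2 + 2 * b * c + a') :=
      Nat.pow_lt_pow_right (by omega) (by omega)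
    simp only [f]
    gcongr
  · intro a
    obtain ⟨e, he⟩ : ∃ e, e = c ^ 2 + 2 * b * c + a := ⟨_, rfl⟩
    have hlt : e < x ^ e := Nat.lt_pow_self (by omega)
    have hexp : (b * x ^ e + c) ^ 2 = (b ^ 2 * x ^ e + 2 * b * c) * x ^ e + c ^ 2 := by ring
    have hdvd : x ∣ x ^ e := dvd_pow_self x (by omega)
    simp only [f, ← he]
    refine ⟨?_, ⟨b * x ^ e + c, 2, ?_, le_rfl, rfl⟩, ?_⟩
    · rw [hexp, ← Nat.dvd_add_iff_right (hdvd.mul_left _)]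
      exact hc
    · have : 0 < b * x ^ e := by positivity
      omega
    · rw [hexp, numNonzeroDigits_mul_pow_add hx _ _ (by omega),
        numNonzeroDigits_mul_pow_add hx _ _ (by omega), h]

/-- The cubes of `x ^ a + 1` have four non-zero digits in base `x ≥ 3`. -/
lemma infinite_perfectPowersWithDigits_four (hx : 3 ≤ x) :
    (perfectPowersWithDigits x 4).Infinite := by
  let f : ℕ → ℕ := fun a ↦ (x ^ (a + 2) + 1) ^ 3
  refine Set.infinite_of_injective_forall_mem (f := f) ?_ ?_
  · refine StrictMono.injective fun a a' haa' ↦ ?_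
    have : x ^ (a + 2) < x ^ (a' + 2) := Nat.pow_lt_pow_right (by omega) (by omega)
    simp only [f]
    gcongr
  · intro a
    obtain ⟨e, he⟩ : ∃ e, e = a + 2 := ⟨_, rfl⟩
    have hlt : 3 < x ^ e := calc
      3 < 3 ^ 2 := by norm_num
      _ ≤ x ^ 2 := Nat.pow_le_pow_left hx 2
      _ ≤ x ^ e := Nat.pow_le_pow_right (by omega) (by omega)
    have hexp : (x ^ e + 1) ^ 3 = ((1 * x ^ e + 3) * x ^ e + 3) * x ^ e + 1 := by ring
    have hdvd : x ∣ x ^ e := dvd_pow_self x (by omega)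
    have hone : numNonzeroDigits x 1 = 1 :=
      numNonzeroDigits_digit (by omega) one_pos (by omega)
    have hthree : numNonzeroDigits x 3 = 1 := by
      rcases hx.eq_or_lt with rfl | h
      · simp [numNonzeroDigits]
      · exact numNonzeroDigits_digit (by omega) (by omega) h
    simp only [f, ← he]
    refine ⟨?_, ⟨x ^ e + 1, 3, by omega, by omega, rfl⟩, ?_⟩
    · rw [hexp, ← Nat.dvd_add_iff_right (hdvd.mul_left _), Nat.dvd_one]
      omega
    · rw [hexp, numNonzeroDigits_mul_pow_add (by omega) _ _ (by omega),
        numNonzeroDigits_mul_pow_add (by omega) _ _ hlt,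
        numNonzeroDigits_mul_pow_add (by omega) _ _ hlt, hone, hthree]

lemma numNonzeroDigits_pow_sub_one_sq (hx : 3 ≤ x) (m : ℕ) :
    numNonzeroDigits x ((x ^ (m + 1) - 1) ^ 2) = m + 2 := by
  have hle : x ≤ x ^ (m + 1) := Nat.le_self_pow (by omega) x
  have key : (x ^ (m + 1) - 1) ^ 2 = (x ^ (m + 1) - 2) * x ^ (m + 1) + 1 := by
    obtain ⟨t, ht⟩ := Nat.exists_eq_add_of_le (show 2 ≤ x ^ (m + 1) by omega)
    rw [ht, Nat.add_sub_cancel_left, show 2 + t - 1 = t + 1 by omega]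
    ring
  rw [key, numNonzeroDigits_mul_pow_add (by omega) _ _ (by omega),
    numNonzeroDigits_pow_succ_sub (by omega) _ (by omega) (by omega),
    numNonzeroDigits_digit (by omega) one_pos (by omega)]

lemma numNonzeroDigits_two_pow_sub_one_sq (m : ℕ) :
    numNonzeroDigits 2 ((2 ^ (m + 1) - 1) ^ 2) = m + 1 := by
  have hpos : 1 ≤ 2 ^ m := Nat.one_le_two_pow
  have key : (2 ^ (m + 1) - 1) ^ 2 = (2 ^ m - 1) * 2 ^ (m + 2) + 1 := by
    obtain ⟨t, ht⟩ := Nat.exists_eq_add_of_le hpos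
    rw [pow_add 2 m 2, pow_succ 2 m, ht, Nat.add_sub_cancel_left,
      show (1 + t) * 2 - 1 = 2 * t + 1 by omega]
    ring
  rw [key, numNonzeroDigits_mul_pow_add le_rfl _ _ (Nat.one_lt_two_pow (by omega)),
    numNonzeroDigits_pow_sub_one le_rfl, numNonzeroDigits_digit le_rfl one_pos (by omega)]

lemma not_dvd_add_one_sq (hx : 2 ≤ x) : ¬ x ∣ (x + 1) ^ 2 := by
  rw [show (x + 1) ^ 2 = (x + 2) * x + 1 by ring,
    ← Nat.dvd_add_iff_right (dvd_mul_left x _), Nat.dvd_one]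
  omega

lemma numNonzeroDigits_add_one_sq (hx : 3 ≤ x) : numNonzeroDigits x ((x + 1) ^ 2) = 3 := by
  rw [show (x + 1) ^ 2 = (1 * x + 2) * x + 1 by ring,
    numNonzeroDigits_mul_add_digit (by omega) _ (by omega) (by omega),
    numNonzeroDigits_mul_add_digit (by omega) _ (by omega) (by omega),
    numNonzeroDigits_digit (by omega) (by omega) (by omega)]

lemma infinite_perfectPowersWithDigits_three (hx : 2 ≤ x) :
    (perfectPowersWithDigits x 3).Infinite := by
  have hone : numNonzeroDigits x 1 = 1 := numNonzeroDigits_digit hx one_pos (by omega)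
  have htwo : numNonzeroDigits x 2 = 1 := by
    rcases hx.eq_or_lt with rfl | h
    · simp [numNonzeroDigits]
    · exact numNonzeroDigits_digit hx (by omega) h
  refine infinite_of_numNonzeroDigits_sq hx (b := 1) (c := 1) one_pos ?_ (by simp [hone, htwo])
  rw [one_pow, Nat.dvd_one]
  omega

lemma infinite_perfectPowersWithDigits_six (hx : 3 ≤ x) :
    (perfectPowersWithDigits x 6).Infinite := by
  refine infinite_of_numNonzeroDigits_sq (by omega) (b := 1) (c := x + 1) one_pos
    (not_dvd_add_one_sq (by omega)) ?_
  rw [numNonzeroDigits_add_one_sq hx, show 2 * 1 * (x + 1) = 2 * x + 2 by ring, one_pow,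
    numNonzeroDigits_mul_add_digit (by omega) _ (by omega) (by omega),
    numNonzeroDigits_digit (by omega) (by omega) (by omega),
    numNonzeroDigits_digit (by omega) (by omega) (by omega)]

lemma infinite_perfectPowersWithDigits_odd (hx : 3 ≤ x) (m : ℕ) :
    (perfectPowersWithDigits x (2 * m + 5)).Infinite := by
  have hle : x ≤ x ^ (m + 1) := Nat.le_self_pow (by omega) x
  refine infinite_of_numNonzeroDigits_sq (by omega) (b := x ^ (m + 1) - 1) (c := 1)
    (by omega) (by rw [one_pow, Nat.dvd_one]; omega) ?_
  rw [numNonzeroDigits_pow_sub_one_sq hx,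
    show 2 * (x ^ (m + 1) - 1) * 1 = 1 * x ^ (m + 1) + (x ^ (m + 1) - 2) by omega,
    numNonzeroDigits_mul_pow_add (by omega) _ _ (by omega),
    numNonzeroDigits_pow_succ_sub (by omega) _ (by omega) (by omega), one_pow,
    numNonzeroDigits_digit (by omega) one_pos (by omega)]
  omega

lemma infinite_perfectPowersWithDigits_even (hx : 4 ≤ x) (m : ℕ) :
    (perfectPowersWithDigits x (2 * m + 8)).Infinite := by
  have hle : x ≤ x ^ (m + 1) := Nat.le_self_pow (by omega) x
  refine infinite_of_numNonzeroDigits_sq (by omega) (b := x ^ (m + 1) - 1) (c := x + 1)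
    (by omega) (not_dvd_add_one_sq (by omega)) ?_
  have key : numNonzeroDigits x (2 * (x ^ (m + 1) - 1) * (x + 1)) = m + 3 := by
    cases m with
    | zero =>
      have h : 2 * (x ^ (0 + 1) - 1) * (x + 1) = (1 * x + (x - 1)) * x + (x - 2) := by
        obtain ⟨t, rfl⟩ := Nat.exists_eq_add_of_le hx
        rw [zero_add, pow_one, show 4 + t - 1 = t + 3 by omega, show 4 + t - 2 = t + 2 by omega]
        ring
      rw [h, numNonzeroDigits_mul_add_digit (by omega) _ (by omega) (by omega),
        numNonzeroDigits_mul_add_digit (by omega) _ (by omega) (by omega),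
        numNonzeroDigits_digit (by omega) (by omega) (by omega)]
    | succ m =>
      have hle' : x ≤ x ^ (m + 1) := Nat.le_self_pow (by omega) x
      obtain ⟨s, hs⟩ := Nat.exists_eq_add_of_le (show 3 ≤ x ^ (m + 1) by omega)
      obtain ⟨t, ht⟩ := Nat.exists_eq_add_of_le (show 2 ≤ x by omega)
      have hpow : x ^ (m + 1 + 1) = s * x + t + (2 * x + 2) := by
        rw [pow_succ, hs, add_mul]
        omega
      have h : 2 * (x ^ (m + 1 + 1) - 1) * (x + 1) =
          (2 * x + 1) * x ^ (m + 1 + 1) + (s * x + t) := by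
        rw [hpow, show s * x + t + (2 * x + 2) - 1 = s * x + t + (2 * x + 1) by omega]
        ring
      rw [h, numNonzeroDigits_mul_pow_add (by omega) _ _ (by omega),
        numNonzeroDigits_mul_add_digit (by omega) _ (by omega) (by omega),
        numNonzeroDigits_mul_add_digit (by omega) _ (by omega) (by omega),
        numNonzeroDigits_digit (by omega) (by omega) (by omega),
        show s = x ^ (m + 1) - 3 by omega,
        numNonzeroDigits_pow_succ_sub (by omega) _ (by omega) (by omega)]
      omega
  rw [numNonzeroDigits_pow_sub_one_sq (by omega), key, numNonzeroDigits_add_one_sq (by omega)]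
  omega

lemma infinite_perfectPowersWithDigits_base_three_even (m : ℕ) :
    (perfectPowersWithDigits 3 (2 * m + 8)).Infinite := by
  have hle : 3 ≤ 3 ^ (m + 1) := Nat.le_self_pow (by omega) 3
  refine infinite_of_numNonzeroDigits_sq (by omega) (b := 3 ^ (m + 1 + 1) - 1) (c := 2)
    (by omega) (by norm_num) ?_
  have h : 2 * (3 ^ (m + 1 + 1) - 1) * 2 =
      1 * 3 ^ (m + 1 + 1 + 1) + ((3 ^ (m + 1) - 2) * 3 + 2) := by omega
  rw [numNonzeroDigits_pow_sub_one_sq le_rfl, h,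
    numNonzeroDigits_mul_pow_add (by omega) _ _ (by omega),
    numNonzeroDigits_mul_add_digit (by omega) _ (by omega) (by omega),
    numNonzeroDigits_pow_succ_sub (by omega) _ (by omega) (by omega),
    numNonzeroDigits_digit (by omega) one_pos (by omega),
    show numNonzeroDigits 3 (2 ^ 2) = 2 by simp [numNonzeroDigits]]
  omega

lemma infinite_perfectPowersWithDigits_base_two_odd (m : ℕ) :
    (perfectPowersWithDigits 2 (2 * m + 3)).Infinite := by
  have hpos : 1 ≤ 2 ^ m := Nat.one_le_two_pow
  refine infinite_of_numNonzeroDigits_sq le_rfl (b := 2 ^ (m + 1) - 1) (c := 1)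
    (by omega) (by norm_num) ?_
  rw [numNonzeroDigits_two_pow_sub_one_sq, mul_one, mul_comm 2,
    numNonzeroDigits_mul_base le_rfl, numNonzeroDigits_pow_sub_one le_rfl, one_pow,
    numNonzeroDigits_digit le_rfl one_pos (by omega)]
  omega

lemma infinite_perfectPowersWithDigits_base_two_even (m : ℕ) :
    (perfectPowersWithDigits 2 (2 * m + 6)).Infinite := by
  have hpos : 1 ≤ 2 ^ m := Nat.one_le_two_pow
  refine infinite_of_numNonzeroDigits_sq le_rfl (b := 2 ^ (m + 1 + 1) - 1) (c := 3)
    (by omega) (by norm_num) ?_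
  have h : 2 * (2 ^ (m + 1 + 1) - 1) * 3 =
      (1 * 2 ^ (m + 1 + 1 + 1) + ((2 ^ m - 1) * 2 * 2 + 1)) * 2 := by omega
  rw [numNonzeroDigits_two_pow_sub_one_sq, h, numNonzeroDigits_mul_base le_rfl,
    numNonzeroDigits_mul_pow_add le_rfl _ _ (by omega),
    numNonzeroDigits_mul_add_digit le_rfl _ (by omega) (by omega),
    numNonzeroDigits_mul_base le_rfl, numNonzeroDigits_pow_sub_one le_rfl,
    numNonzeroDigits_digit le_rfl one_pos (by omega),
    show numNonzeroDigits 2 (3 ^ 2) = 2 by simp [numNonzeroDigits]]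
  omega

end

theorem infinitely_many_perfect_powers_with_k_digits
    (x k : ℕ) (hx : 2 ≤ x) (hk : 3 ≤ k) (hxk : ¬(x = 2 ∧ k = 4)) :
    {n : ℕ | ¬ x ∣ n ∧ (∃ y d : ℕ, 2 ≤ y ∧ 2 ≤ d ∧ n = y ^ d) ∧
      ((Nat.digits x n).filter (· ≠ 0)).length = k}.Infinite := by
  change (perfectPowersWithDigits x k).Infinite
  rcases hx.eq_or_lt with rfl | hx3
  · rcases Nat.even_or_odd' k with ⟨j, rfl | rfl⟩
    · obtain ⟨m, rfl⟩ := Nat.exists_eq_add_of_le (show 3 ≤ j by omega)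
      convert infinite_perfectPowersWithDigits_base_two_even m using 2
      omega
    · obtain ⟨m, rfl⟩ := Nat.exists_eq_add_of_le (show 1 ≤ j by omega)
      convert infinite_perfectPowersWithDigits_base_two_odd m using 2
      omega
  · obtain rfl | rfl | rfl | hk' | hk' :
        k = 3 ∨ k = 4 ∨ k = 6 ∨ (∃ m, k = 2 * m + 5) ∨ (∃ m, k = 2 * m + 8) := by
      rcases Nat.even_or_odd' k with ⟨j, rfl | rfl⟩
      · by_cases h : 4 ≤ j
        · exact .inr (.inr (.inr (.inr ⟨j - 4, by omega⟩)))
        · omega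
      · by_cases h : 2 ≤ j
        · exact .inr (.inr (.inr (.inl ⟨j - 2, by omega⟩)))
        · omega
    · exact infinite_perfectPowersWithDigits_three hx
    · exact infinite_perfectPowersWithDigits_four hx3
    · exact infinite_perfectPowersWithDigits_six hx3
    · obtain ⟨m, rfl⟩ := hk'
      exact infinite_perfectPowersWithDigits_odd hx3 m
    · obtain ⟨m, rfl⟩ := hk'
      rcases (Nat.succ_le_of_lt hx3).eq_or_lt with rfl | hx4
      · exact infinite_perfectPowersWithDigits_base_three_even m
      · exact infinite_perfectPowersWithDigits_even hx4 m
end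

section
/- Let x ≥ 2 and k ≥ 3 be integers with (x, k) ≠ (2, 4) and (x, k) ≠ (3, 4). Then there exist infinitely many perfect squares not divisible by x having exactly k non-zero digits in their base-x representation. -/
/-- The number of non-zero digits of `n` in base `x`. -/
def nonzeroDigitCount (x n : ℕ) : ℕ := ((Nat.digits x n).filter (· ≠ 0)).length

lemma nonzeroDigitCount_zero (x : ℕ) : nonzeroDigitCount x 0 = 0 := by
  simp [nonzeroDigitCount]

lemma nonzeroDigitCount_mul_add_digit {x d : ℕ} (hx : 2 ≤ x) (hd : d < x) (a : ℕ) :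
    nonzeroDigitCount x (a * x + d) = nonzeroDigitCount x a + if d = 0 then 0 else 1 := by
  by_cases h : d = 0 ∧ a = 0
  · simp [h.1, h.2, nonzeroDigitCount_zero]
  · have hne : d ≠ 0 ∨ a ≠ 0 := by tauto
    unfold nonzeroDigitCount
    rw [add_comm, mul_comm, Nat.digits_add x hx d a hd hne, List.filter_cons]
    split_ifs <;> simp_all

lemma nonzeroDigitCount_digit {x d : ℕ} (h0 : 0 < d) (hd : d < x) :
    nonzeroDigitCount x d = 1 := by
  have := nonzeroDigitCount_mul_add_digit (by omega) hd 0
  simpa [nonzeroDigitCount_zero, h0.ne'] using this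

/-- Digit blocks that do not overlap contribute independently. -/
lemma nonzeroDigitCount_mul_pow_add {x : ℕ} (hx : 2 ≤ x) (a : ℕ) {b N : ℕ} (hb : b < x ^ N) :
    nonzeroDigitCount x (a * x ^ N + b) = nonzeroDigitCount x a + nonzeroDigitCount x b := by
  induction N generalizing b with
  | zero =>
    obtain rfl : b = 0 := by simpa using hb
    simp [nonzeroDigitCount_zero]
  | succ N ih =>
    have hm : b % x < x := Nat.mod_lt _ (by omega)
    have hq : b / x < x ^ N := Nat.div_lt_of_lt_mul (by rwa [pow_succ'] at hb)
    have hdecomp : b = b / x * x + b % x := (Nat.div_add_mod' b x).symm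
    have hsum : a * x ^ (N + 1) + b = (a * x ^ N + b / x) * x + b % x := by
      rw [pow_succ]; nlinarith
    have hb' : nonzeroDigitCount x b = _ :=
      (congrArg _ hdecomp).trans (nonzeroDigitCount_mul_add_digit hx hm (b / x))
    rw [hsum, nonzeroDigitCount_mul_add_digit hx hm, ih hq, hb', add_assoc]

lemma nonzeroDigitCount_of_succ_eq_pow {x : ℕ} (hx : 2 ≤ x) {p j : ℕ} (hp : p + 1 = x ^ j) :
    nonzeroDigitCount x p = j := by
  induction j generalizing p with
  | zero =>
    obtain rfl : p = 0 := by simpa using hp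
    exact nonzeroDigitCount_zero x
  | succ j ih =>
    obtain ⟨q, hq⟩ := Nat.exists_eq_succ_of_ne_zero (pow_pos (by omega : 0 < x) j).ne'
    have hpq : p = q * x + (x - 1) := by
      rw [pow_succ, hq, Nat.succ_mul] at hp; omega
    rw [hpq, nonzeroDigitCount_mul_add_digit hx (by omega), ih hq.symm,
      if_neg (by omega : x - 1 ≠ 0)]

lemma not_dvd_mul_pow_add {x i r : ℕ} (hi : i ≠ 0) (hr : ¬ x ∣ r) (q : ℕ) :
    ¬ x ∣ q * x ^ i + r := fun h =>
  hr ((Nat.dvd_add_right (Dvd.dvd.mul_left (dvd_pow_self x hi) q)).1 h)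

/-- The perfect squares not divisible by `x` with exactly `k` non-zero digits in base `x`. -/
def squaresWithDigitCount (x k : ℕ) : Set ℕ :=
  {n : ℕ | ¬ x ∣ n ∧ (∃ m : ℕ, n = m ^ 2) ∧ nonzeroDigitCount x n = k}

/-- The squares `(A * x ^ N + B) ^ 2` with `N` large all have the same number of non-zero digits. -/
lemma infinite_squaresWithDigitCount {x k A B : ℕ} (hx : 2 ≤ x) (hA : 0 < A) (hB : ¬ x ∣ B ^ 2)
    (hk : nonzeroDigitCount x (A ^ 2) + nonzeroDigitCount x (2 * A * B) +
      nonzeroDigitCount x (B ^ 2) = k) :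
    (squaresWithDigitCount x k).Infinite := by
  refine Set.infinite_of_injective_forall_mem
    (f := fun j : ℕ => (A * x ^ (j + (2 * A * B + B ^ 2 + 1)) + B) ^ 2) ?_ ?_
  · intro i j hij
    have h1 := Nat.pow_left_injective (n := 2) (by norm_num) hij
    have h2 := Nat.eq_of_mul_eq_mul_left hA (Nat.add_right_cancel h1)
    have h3 := Nat.pow_right_injective hx h2
    omega
  · intro j
    set N := j + (2 * A * B + B ^ 2 + 1) with hN
    have hlt : N < x ^ N := Nat.lt_pow_self hx
    have hsq : (A * x ^ N + B) ^ 2 = (A ^ 2 * x ^ N + 2 * A * B) * x ^ N + B ^ 2 := by ring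
    refine ⟨?_, ⟨_, rfl⟩, ?_⟩
    · simp only [hsq]
      exact not_dvd_mul_pow_add (by omega) hB _
    · simp only [hsq]
      rw [nonzeroDigitCount_mul_pow_add hx _ (by omega),
        nonzeroDigitCount_mul_pow_add hx _ (by omega), hk]

/-- The case `A = 1`, `B = x ^ (i + j) - d` with `r = x ^ i - 2 * d`. -/
lemma infinite_squaresWithDigitCount_pow_sub {x i d r : ℕ} (j : ℕ) (hx : 2 ≤ x) (hi : i ≠ 0)
    (hd0 : 0 < d) (hr : r + 2 * d = x ^ i) (hd : d ^ 2 < x ^ i) (hxd : ¬ x ∣ d ^ 2) :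
    (squaresWithDigitCount x
      (2 + 2 * (j + nonzeroDigitCount x r) + nonzeroDigitCount x (d ^ 2))).Infinite := by
  obtain ⟨p, hp⟩ := Nat.exists_eq_succ_of_ne_zero (pow_pos (by omega : 0 < x) j).ne'
  obtain ⟨U, hU⟩ : ∃ U, U = p * x ^ i + r := ⟨_, rfl⟩
  have hT : x ^ (j + i) = U + 2 * d := by
    rw [pow_add, hp, Nat.succ_mul, hU]; omega
  have hsU : nonzeroDigitCount x U = j + nonzeroDigitCount x r := by
    rw [hU, nonzeroDigitCount_mul_pow_add hx _ (by omega),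
      nonzeroDigitCount_of_succ_eq_pow hx hp.symm]
  have hdT : d ^ 2 < x ^ (j + i) := hd.trans_le (Nat.pow_le_pow_right (by omega) (by omega))
  have hsq : (U + d) ^ 2 = U * x ^ (j + i) + d ^ 2 := by rw [hT]; ring
  have hdouble : 2 * 1 * (U + d) = 1 * x ^ (j + i) + U := by rw [hT]; ring
  refine infinite_squaresWithDigitCount (A := 1) (B := U + d) hx one_pos ?_ ?_
  · rw [hsq]
    exact not_dvd_mul_pow_add (by omega) hxd _
  · rw [hsq, hdouble, nonzeroDigitCount_mul_pow_add hx _ hdT,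
      nonzeroDigitCount_mul_pow_add hx _ (by omega), hsU, one_pow,
      nonzeroDigitCount_digit one_pos hx]
    ring

/-- The case `A = 1`, `B = 2 * x ^ (j + 1) - 1`. -/
lemma infinite_squaresWithDigitCount_two_mul_pow_sub_one {x : ℕ} (j : ℕ) (hx : 5 ≤ x) :
    (squaresWithDigitCount x (2 * j + 6)).Infinite := by
  have hx2 : 2 ≤ x := by omega
  obtain ⟨p, hp⟩ := Nat.exists_eq_succ_of_ne_zero (pow_pos (by omega : 0 < x) j).ne'
  obtain ⟨U, hU⟩ : ∃ U, U = p * x + (x - 4) := ⟨_, rfl⟩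
  have hU2 : U + 2 = p * x + (x - 2) := by omega
  have hT : x ^ (j + 1) = U + 4 := by
    rw [pow_succ, hp, Nat.succ_mul, hU]; omega
  have hsp := nonzeroDigitCount_of_succ_eq_pow hx2 hp.symm
  have hsU : nonzeroDigitCount x U = j + 1 := by
    rw [hU, nonzeroDigitCount_mul_add_digit hx2 (by omega), hsp, if_neg (by omega)]
  have hsU2 : nonzeroDigitCount x (U + 2) = j + 1 := by
    rw [hU2, nonzeroDigitCount_mul_add_digit hx2 (by omega), hsp, if_neg (by omega)]
  have hsq : (2 * U + 7) ^ 2 = (3 * x ^ (j + 1) + U) * x ^ (j + 1) + 1 := by rw [hT]; ring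
  have hdouble : 2 * 1 * (2 * U + 7) = 3 * x ^ (j + 1) + (U + 2) := by rw [hT]; ring
  refine infinite_squaresWithDigitCount (A := 1) (B := 2 * U + 7) hx2 one_pos ?_ ?_
  · rw [hsq]
    refine not_dvd_mul_pow_add (by omega) (fun h => ?_) _
    have := Nat.le_of_dvd one_pos h
    omega
  · rw [hsq, hdouble, nonzeroDigitCount_mul_pow_add hx2 _ (by omega),
      nonzeroDigitCount_mul_pow_add hx2 _ (by omega),
      nonzeroDigitCount_mul_pow_add hx2 _ (by omega), hsU, hsU2, one_pow,
      nonzeroDigitCount_digit one_pos hx2, nonzeroDigitCount_digit (by omega : 0 < 3) (by omega)]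
    ring

lemma infinite_squaresWithDigitCount_odd {x : ℕ} (j : ℕ) (hx : 2 ≤ x) :
    (squaresWithDigitCount x (2 * j + 3)).Infinite := by
  have h1 : ¬ x ∣ 1 ^ 2 := fun h => by
    have := Nat.le_of_dvd (by norm_num) h
    omega
  have hs1 : nonzeroDigitCount x (1 ^ 2) = 1 := by
    rw [one_pow, nonzeroDigitCount_digit one_pos hx]
  rcases hx.eq_or_lt with rfl | hx3
  · have := infinite_squaresWithDigitCount_pow_sub (x := 2) (i := 1) (d := 1) (r := 0) j
      le_rfl one_ne_zero one_pos (by norm_num) (by norm_num) h1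
    rw [hs1, nonzeroDigitCount_zero] at this
    convert this using 2
    ring
  · cases j with
    | zero =>
      refine infinite_squaresWithDigitCount (A := 1) (B := 1) hx one_pos h1 ?_
      rw [hs1, nonzeroDigitCount_digit (by norm_num) (by omega)]
    | succ j =>
      have := infinite_squaresWithDigitCount_pow_sub (x := x) (i := 1) (d := 1) (r := x - 2) j
        hx one_ne_zero one_pos (by rw [pow_one]; omega) (by rw [pow_one]; omega) h1
      rw [hs1, nonzeroDigitCount_digit (by omega) (by omega)] at this
      convert this using 2
      ring

lemma infinite_squaresWithDigitCount_four {x : ℕ} (hx : 4 ≤ x) :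
    (squaresWithDigitCount x 4).Infinite := by
  obtain rfl | rfl | hx6 : x = 4 ∨ x = 5 ∨ 6 ≤ x := by omega
  · exact infinite_squaresWithDigitCount (A := 2) (B := 3) (by norm_num) (by norm_num)
      (by norm_num) (by simp [nonzeroDigitCount])
  · exact infinite_squaresWithDigitCount (A := 2) (B := 2) (by norm_num) (by norm_num)
      (by norm_num) (by simp [nonzeroDigitCount])
  · have hx2 : 2 ≤ x := by omega
    obtain ⟨r, hr⟩ : ∃ r, r = Nat.sqrt x := ⟨_, rfl⟩
    have hle : r * r ≤ x := hr ▸ Nat.sqrt_le x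
    have hlt : x < (r + 1) * (r + 1) := hr ▸ Nat.lt_succ_sqrt x
    have hbound : 2 * r + 1 < x := by
      rcases le_or_gt r 2 with h | h
      · omega
      · nlinarith
    have hsq : (r + 1) ^ 2 = 1 * x + ((r + 1) * (r + 1) - x) := by
      rw [sq]; omega
    have hrest : (r + 1) * (r + 1) - x < x := by
      have : (r + 1) * (r + 1) = r * r + 2 * r + 1 := by ring
      omega
    refine infinite_squaresWithDigitCount (A := r + 1) (B := 1) hx2 (by omega) ?_ ?_
    · intro h
      have := Nat.le_of_dvd (by norm_num) h
      omega
    · have hs2 : nonzeroDigitCount x (2 * (r + 1) * 1) = 1 := by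
        rcases (show 2 * (r + 1) ≤ x by omega).eq_or_lt with h | h
        · have := nonzeroDigitCount_mul_add_digit hx2 (by omega : 0 < x) 1
          rw [mul_one, h]
          simpa [nonzeroDigitCount_digit one_pos hx2] using this
        · exact nonzeroDigitCount_digit (by omega) (by omega)
      rw [hs2, hsq, nonzeroDigitCount_mul_add_digit hx2 hrest, if_neg (by omega), one_pow,
        nonzeroDigitCount_digit one_pos hx2]

lemma infinite_squaresWithDigitCount_even {x : ℕ} (j : ℕ) (hx : 2 ≤ x) :
    (squaresWithDigitCount x (2 * j + 6)).Infinite := by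
  obtain h5 | hx4 := le_or_gt 5 x
  · exact infinite_squaresWithDigitCount_two_mul_pow_sub_one j h5
  cases j with
  | zero =>
    interval_cases x
    · exact infinite_squaresWithDigitCount (A := 1) (B := 5) (by norm_num) (by norm_num)
        (by norm_num) (by simp [nonzeroDigitCount])
    · exact infinite_squaresWithDigitCount (A := 1) (B := 10) (by norm_num) (by norm_num)
        (by norm_num) (by simp [nonzeroDigitCount])
    · exact infinite_squaresWithDigitCount (A := 1) (B := 17) (by norm_num) (by norm_num)
        (by norm_num) (by simp [nonzeroDigitCount])
  | succ j =>
    interval_cases x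
    · convert infinite_squaresWithDigitCount_pow_sub (x := 2) (i := 4) (d := 3) (r := 10) j
        (by norm_num) (by norm_num) (by norm_num) (by norm_num) (by norm_num) (by norm_num) using 2
      simp [nonzeroDigitCount]
      ring
    · convert infinite_squaresWithDigitCount_pow_sub (x := 3) (i := 2) (d := 2) (r := 5) j
        (by norm_num) (by norm_num) (by norm_num) (by norm_num) (by norm_num) (by norm_num) using 2
      simp [nonzeroDigitCount]
      ring
    · convert infinite_squaresWithDigitCount_pow_sub (x := 4) (i := 2) (d := 3) (r := 10) j
        (by norm_num) (by norm_num) (by norm_num) (by norm_num) (by norm_num) (by norm_num) using 2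
      simp [nonzeroDigitCount]
      ring

theorem infinitely_many_perfect_squares_with_k_digits
    (x k : ℕ) (hx : 2 ≤ x) (hk : 3 ≤ k)
    (hxk2 : ¬(x = 2 ∧ k = 4)) (hxk3 : ¬(x = 3 ∧ k = 4)) :
    {n : ℕ | ¬ x ∣ n ∧ (∃ m : ℕ, n = m ^ 2) ∧
      ((Nat.digits x n).filter (· ≠ 0)).length = k}.Infinite := by
  change (squaresWithDigitCount x k).Infinite
  obtain rfl | ⟨j, rfl⟩ | ⟨j, rfl⟩ :
      k = 4 ∨ (∃ j, k = 2 * j + 3) ∨ ∃ j, k = 2 * j + 6 := by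
    rcases Nat.even_or_odd' k with ⟨c, hc | hc⟩
    · rcases (show c = 2 ∨ 3 ≤ c by omega) with h | h
      · exact Or.inl (by omega)
      · exact Or.inr (Or.inr ⟨c - 3, by omega⟩)
    · exact Or.inr (Or.inl ⟨c - 1, by omega⟩)
  · exact infinite_squaresWithDigitCount_four (by omega)
  · exact infinite_squaresWithDigitCount_odd j hx
  · exact infinite_squaresWithDigitCount_even j hx
end

section
/- Let k be a positive integer greater than 4 that is not of the form p(p−1)/2 + 1 for any positive integer p, and let x ≥ 3 be an integer. Then there exist infinitely many perfect squares not divisible by x having exactly k non-zero digits in their base-x representation. -/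
lemma nonzeroDigitCount_of_lt {x n : ℕ} (h0 : n ≠ 0) (hn : n < x) :
    nonzeroDigitCount x n = 1 := by
  simp [nonzeroDigitCount, Nat.digits_of_lt x n h0 hn, h0]

lemma nonzeroDigitCount_add_mul {x d : ℕ} (b : ℕ) (hx : 2 ≤ x) (hd : d < x) :
    nonzeroDigitCount x (d + x * b) = nonzeroDigitCount x d + nonzeroDigitCount x b := by
  rcases Nat.eq_zero_or_pos d with rfl | hd0
  · rcases Nat.eq_zero_or_pos b with rfl | hb
    · simp [nonzeroDigitCount]
    · simp [nonzeroDigitCount, Nat.digits_base_mul (by lia : 1 < x) hb]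
  · rw [nonzeroDigitCount_of_lt hd0.ne' hd]
    simp only [nonzeroDigitCount]
    rw [Nat.digits_add x (by lia) d b hd (Or.inl hd0.ne')]
    simp [hd0.ne', add_comm]

lemma nonzeroDigitCount_add_pow_mul {x : ℕ} (hx : 2 ≤ x) (b L : ℕ) {a : ℕ} (ha : a < x ^ L) :
    nonzeroDigitCount x (a + x ^ L * b) = nonzeroDigitCount x a + nonzeroDigitCount x b := by
  induction L generalizing a with
  | zero =>
    obtain rfl : a = 0 := by simpa using ha
    simp [nonzeroDigitCount]
  | succ L ih =>
    have hd : a % x < x := Nat.mod_lt _ (by lia)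
    have hq : a / x < x ^ L := Nat.div_lt_of_lt_mul (by rwa [pow_succ'] at ha)
    have ha' : a % x + x * (a / x) = a := Nat.mod_add_div a x
    have hsplit : a + x ^ (L + 1) * b = a % x + x * (a / x + x ^ L * b) := by
      conv_lhs => rw [← ha']
      ring
    rw [hsplit, nonzeroDigitCount_add_mul _ hx hd, ih hq, ← add_assoc,
      ← nonzeroDigitCount_add_mul _ hx hd, ha']

lemma nonzeroDigitCount_three {x : ℕ} (hx : 3 ≤ x) : nonzeroDigitCount x 3 = 1 := by
  rcases hx.eq_or_lt with rfl | h
  · simp [nonzeroDigitCount]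
  · exact nonzeroDigitCount_of_lt (by lia) h

/-- Arbitrarily large `Y = x ^ L` admit an `r` such that `a = r + Y` has `m` terms in base `x`
and `a ^ 2` has `k` non-zero digits, in a form allowing a further term to be appended to `a`. -/
def HasSparseSquareRoot (x m k : ℕ) : Prop :=
  ∀ B : ℕ, ∃ L r : ℕ, B ≤ L ∧ 2 ≤ L ∧ r % x = 1 ∧ 3 * r < x ^ L ∧
    nonzeroDigitCount x (r ^ 2 + 2 * r * x ^ L) + 1 = k ∧
    nonzeroDigitCount x (2 * (r + x ^ L)) = m ∧
    nonzeroDigitCount x (1 + 2 * (r + x ^ L)) = m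

lemma nine_le_pow {x L : ℕ} (hx : 3 ≤ x) (hL : 2 ≤ L) : 9 ≤ x ^ L :=
  calc 9 = 3 ^ 2 := by norm_num
    _ ≤ x ^ 2 := Nat.pow_le_pow_left hx 2
    _ ≤ x ^ L := Nat.pow_le_pow_right (by lia) hL

lemma nonzeroDigitCount_sq {x L r : ℕ} (hx : 3 ≤ x) (hr : 3 * r < x ^ L) :
    nonzeroDigitCount x ((r + x ^ L) ^ 2) =
      nonzeroDigitCount x (r ^ 2 + 2 * r * x ^ L) + 1 := by
  have h : (r + x ^ L) ^ 2 = (r ^ 2 + 2 * r * x ^ L) + x ^ (L * 2) * 1 := by ring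
  rw [h, nonzeroDigitCount_add_pow_mul (by lia) _ _ (by rw [pow_mul]; nlinarith),
    nonzeroDigitCount_of_lt one_ne_zero (by lia)]

lemma hasSparseSquareRoot_two_three {x : ℕ} (hx : 3 ≤ x) : HasSparseSquareRoot x 2 3 := by
  intro B
  have h9 : 9 ≤ x ^ (B + 2) := nine_le_pow hx (by lia)
  have h1 := nonzeroDigitCount_of_lt (x := x) one_ne_zero (by lia)
  have h2 := nonzeroDigitCount_of_lt (x := x) two_ne_zero (by lia)
  have key (c : ℕ) (hc : c < 9) :
      nonzeroDigitCount x (c + x ^ (B + 2) * 2) = nonzeroDigitCount x c + 1 := by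
    rw [nonzeroDigitCount_add_pow_mul (by lia) _ _ (by lia), h2]
  refine ⟨B + 2, 1, by lia, by lia, Nat.mod_eq_of_lt (by lia), by lia, ?_, ?_, ?_⟩
  · rw [show 1 ^ 2 + 2 * 1 * x ^ (B + 2) = 1 + x ^ (B + 2) * 2 by ring, key _ (by lia), h1]
  · rw [show 2 * (1 + x ^ (B + 2)) = 2 + x ^ (B + 2) * 2 by ring, key _ (by lia), h2]
  · rw [show 1 + 2 * (1 + x ^ (B + 2)) = 3 + x ^ (B + 2) * 2 by ring, key _ (by lia),
      nonzeroDigitCount_three hx]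

/-- Appending the term `x ^ L'` to `a` creates one more term in `2 * a` and in `1 + 2 * a`. -/
lemma nonzeroDigitCount_append {x a m L' : ℕ} (hx : 3 ≤ x) (ha : 1 + 2 * a < x ^ L')
    (h2 : nonzeroDigitCount x (2 * a) = m) (h3 : nonzeroDigitCount x (1 + 2 * a) = m) :
    nonzeroDigitCount x (2 * (a + x ^ L')) = m + 1 ∧
      nonzeroDigitCount x (1 + 2 * (a + x ^ L')) = m + 1 := by
  have htwo := nonzeroDigitCount_of_lt (x := x) two_ne_zero (by lia)
  constructor
  · rw [show 2 * (a + x ^ L') = 2 * a + x ^ L' * 2 by ring,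
      nonzeroDigitCount_add_pow_mul (by lia) _ _ (by lia), h2, htwo]
  · rw [show 1 + 2 * (a + x ^ L') = (1 + 2 * a) + x ^ L' * 2 by ring,
      nonzeroDigitCount_add_pow_mul (by lia) _ _ ha, h3, htwo]

lemma add_pow_mod {x L r : ℕ} (hL : 2 ≤ L) (hr : r % x = 1) : (r + x ^ L) % x = 1 := by
  obtain ⟨l, rfl⟩ : ∃ l, L = l + 1 := ⟨L - 1, by lia⟩
  rw [pow_succ', Nat.add_mul_mod_self_left, hr]

/-- Appending the square of the leading power: one pair of terms of the square collides. -/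
lemma HasSparseSquareRoot.append_colliding {x m k : ℕ} (hx : 3 ≤ x)
    (h : HasSparseSquareRoot x m k) : HasSparseSquareRoot x (m + 1) (k + m) := by
  intro B
  obtain ⟨L, r, hB, hL, hr, h3r, hk, h2, h3⟩ := h B
  have h9 := nine_le_pow hx hL
  have hlt : 3 * (r + x ^ L) < x ^ (L * 2) := by rw [pow_mul]; nlinarith
  have hbig : 9 ≤ x ^ (L * 2) := nine_le_pow hx (by lia)
  refine ⟨L * 2, r + x ^ L, by lia, by lia, add_pow_mod hL hr, hlt, ?_,
    nonzeroDigitCount_append hx (by lia) h2 h3⟩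
  have hsplit : (r + x ^ L) ^ 2 + 2 * (r + x ^ L) * x ^ (L * 2) =
      (r ^ 2 + 2 * r * x ^ L) + x ^ (L * 2) * (1 + 2 * (r + x ^ L)) := by ring
  rw [hsplit, nonzeroDigitCount_add_pow_mul (by lia) _ _ (by rw [pow_mul]; nlinarith), h3]
  lia

/-- Appending the cube of the leading power: no two terms of the square collide. -/
lemma HasSparseSquareRoot.append_isolated {x m k : ℕ} (hx : 3 ≤ x)
    (h : HasSparseSquareRoot x m k) : HasSparseSquareRoot x (m + 1) (k + m + 1) := by
  intro B
  obtain ⟨L, r, hB, hL, hr, h3r, hk, h2, h3⟩ := h B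
  have h9 := nine_le_pow hx hL
  have hsq : (r + x ^ L) ^ 2 < x ^ (L * 3) := by
    rw [pow_mul]
    have hpos : 0 < (x ^ L) ^ 2 := by positivity
    have : (r + x ^ L) ^ 2 < 9 * (x ^ L) ^ 2 := by nlinarith
    nlinarith
  have hlt : 3 * (r + x ^ L) < x ^ (L * 3) := by nlinarith
  have hbig : 9 ≤ x ^ (L * 3) := nine_le_pow hx (by lia)
  refine ⟨L * 3, r + x ^ L, by lia, by lia, add_pow_mod hL hr, hlt, ?_,
    nonzeroDigitCount_append hx (by lia) h2 h3⟩
  have hsplit : (r + x ^ L) ^ 2 + 2 * (r + x ^ L) * x ^ (L * 3) =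
      (r + x ^ L) ^ 2 + x ^ (L * 3) * (2 * (r + x ^ L)) := by ring
  rw [hsplit, nonzeroDigitCount_add_pow_mul (by lia) _ _ hsq, h2, nonzeroDigitCount_sq hx h3r]
  lia

lemma hasSparseSquareRoot_of_choose {x m k : ℕ} (hx : 3 ≤ x) (hm : 2 ≤ m)
    (hlow : m.choose 2 + 2 ≤ k) (hup : k ≤ (m + 1).choose 2) : HasSparseSquareRoot x m k := by
  induction m, hm using Nat.le_induction generalizing k with
  | base =>
    obtain rfl : k = 3 := by
      simp only [Nat.choose_self] at hlow
      norm_num [Nat.choose] at hup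
      lia
    exact hasSparseSquareRoot_two_three hx
  | succ m hm ih =>
    have e1 : (m + 1).choose 2 = m + m.choose 2 := by simp [Nat.choose_succ_succ']
    have e2 : (m + 1 + 1).choose 2 = (m + 1) + (m + 1).choose 2 := by
      simp [Nat.choose_succ_succ' (m + 1)]
    rcases hlow.eq_or_lt with h | h
    · have := (ih (k := k - m) (by lia) (by lia)).append_colliding hx
      rwa [Nat.sub_add_cancel (by lia)] at this
    · have := (ih (k := k - (m + 1)) (by lia) (by lia)).append_isolated hx
      rwa [add_assoc, Nat.sub_add_cancel (by lia)] at this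

lemma exists_choose_two_bounds {k : ℕ} (hk : 3 ≤ k) :
    ∃ m, 2 ≤ m ∧ m.choose 2 + 2 ≤ k ∧ k ≤ (m + 1).choose 2 + 1 := by
  induction k, hk using Nat.le_induction with
  | base => exact ⟨2, by decide⟩
  | succ k hk ih =>
    obtain ⟨m, hm, h1, h2⟩ := ih
    rcases h2.eq_or_lt with h | h
    · have e : (m + 1 + 1).choose 2 = (m + 1) + (m + 1).choose 2 := by
        simp [Nat.choose_succ_succ' (m + 1)]
      exact ⟨m + 1, by lia, by lia, by lia⟩
    · exact ⟨m, hm, by lia, h⟩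

theorem infinitely_many_squares_base_x_not_triangular_form
    (k x : ℕ) (hk : 4 < k)
    (hform : ¬ ∃ p : ℕ, 0 < p ∧ k = p * (p - 1) / 2 + 1)
    (hx : 3 ≤ x) :
    {n : ℕ | ¬ x ∣ n ∧ (∃ m : ℕ, n = m ^ 2) ∧
      ((Nat.digits x n).filter (· ≠ 0)).length = k}.Infinite := by
  obtain ⟨m, hm, h1, h2⟩ := exists_choose_two_bounds (k := k) (by lia)
  have hne : k ≠ (m + 1).choose 2 + 1 := fun h =>
    hform ⟨m + 1, by lia, by rwa [Nat.choose_two_right] at h⟩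
  have hroot := hasSparseSquareRoot_of_choose hx hm h1 (by lia)
  refine Set.infinite_of_forall_exists_gt fun B => ?_
  obtain ⟨L, r, hB, hL, hr, h3r, hcount, -⟩ := hroot B
  refine ⟨(r + x ^ L) ^ 2, ⟨?_, ⟨_, rfl⟩, (nonzeroDigitCount_sq hx h3r).trans hcount⟩, ?_⟩
  · rw [Nat.dvd_iff_mod_eq_zero, Nat.pow_mod, add_pow_mod hL hr, one_pow,
      Nat.mod_eq_of_lt (by lia)]
    exact one_ne_zero
  · have : L < x ^ L := Nat.lt_pow_self (by lia)
    nlinarith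
end

section
/- Let k ≥ 7 be an integer of the form p(p−1)/2 + 1 for some positive integer p. Then there are infinitely many perfect squares not divisible by 3 having exactly k non-zero digits in their base-3 representation. -/
/-- The number of non-zero ternary digits of `n`. -/
def nonzeroTernaryDigits (n : ℕ) : ℕ := ((Nat.digits 3 n).filter (· ≠ 0)).length

theorem nonzeroTernaryDigits_eq_add_div (n : ℕ) :
    nonzeroTernaryDigits n = (if n % 3 = 0 then 0 else 1) + nonzeroTernaryDigits (n / 3) := by
  rcases Nat.eq_zero_or_pos n with rfl | hn
  · simp [nonzeroTernaryDigits]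
  · unfold nonzeroTernaryDigits
    rw [Nat.digits_def' (by norm_num) hn, List.filter_cons]
    by_cases h : n % 3 = 0
    · simp [h]
    · simp [h, Nat.add_comm]

theorem nonzeroTernaryDigits_add_three_pow_mul (e a b : ℕ) (h : a < 3 ^ e) :
    nonzeroTernaryDigits (a + 3 ^ e * b) = nonzeroTernaryDigits a + nonzeroTernaryDigits b := by
  induction e generalizing a with
  | zero =>
    obtain rfl : a = 0 := by simpa using h
    simp [nonzeroTernaryDigits]
  | succ e ih =>
    have hdvd : 3 ^ (e + 1) * b = 3 * (3 ^ e * b) := by ring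
    rw [pow_succ] at h
    rw [nonzeroTernaryDigits_eq_add_div (a + _), nonzeroTernaryDigits_eq_add_div a, hdvd,
      Nat.add_mul_mod_self_left, Nat.add_mul_div_left _ _ (by norm_num : 0 < 3),
      ih (a / 3) (by lia)]
    ring

theorem nonzeroTernaryDigits_two_mul_add_three_pow {m e : ℕ} (h : 2 * m < 3 ^ e) :
    nonzeroTernaryDigits (2 * (m + 3 ^ e)) = nonzeroTernaryDigits (2 * m) + 1 := by
  have h2 : nonzeroTernaryDigits 2 = 1 := by simp [nonzeroTernaryDigits]
  rw [show 2 * (m + 3 ^ e) = 2 * m + 3 ^ e * 2 by ring,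
    nonzeroTernaryDigits_add_three_pow_mul _ _ _ h, h2]

theorem nonzeroTernaryDigits_sq_add_three_pow {m e : ℕ} (h : 2 * m < 3 ^ e)
    (hsq : m ^ 2 < 3 ^ e) :
    nonzeroTernaryDigits ((m + 3 ^ e) ^ 2) =
      nonzeroTernaryDigits (m ^ 2) + nonzeroTernaryDigits (2 * m) + 1 := by
  have h1 : nonzeroTernaryDigits 1 = 1 := by simp [nonzeroTernaryDigits]
  rw [show (m + 3 ^ e) ^ 2 = m ^ 2 + 3 ^ e * (2 * m + 3 ^ e * 1) by ring,
    nonzeroTernaryDigits_add_three_pow_mul _ _ _ hsq,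
    nonzeroTernaryDigits_add_three_pow_mul _ _ _ h, h1, add_assoc]

/-- Adding a large power of three to `m` controls the digits of both `2 * m` and `m ^ 2`. -/
theorem exists_gt_nonzeroTernaryDigits (m B : ℕ) (hm : ¬ 3 ∣ m) :
    ∃ m' > B, ¬ 3 ∣ m' ∧
      nonzeroTernaryDigits (2 * m') = nonzeroTernaryDigits (2 * m) + 1 ∧
      nonzeroTernaryDigits (m' ^ 2) =
        nonzeroTernaryDigits (m ^ 2) + nonzeroTernaryDigits (2 * m) + 1 := by
  obtain ⟨e, he⟩ : ∃ e, B + 2 * m + m ^ 2 + 1 < 3 ^ e :=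
    ⟨_, Nat.lt_pow_self (by norm_num)⟩
  have he0 : e ≠ 0 := by
    rintro rfl
    simp at he
  refine ⟨m + 3 ^ e, by lia, ?_, nonzeroTernaryDigits_two_mul_add_three_pow (by lia),
    nonzeroTernaryDigits_sq_add_three_pow (by lia) (by lia)⟩
  rwa [← Nat.dvd_add_iff_left (dvd_pow_self 3 he0)]

/-- Starting from `14`, whose double is `1001` and whose square is `21021` in base three. -/
theorem exists_nonzeroTernaryDigits_sq (r : ℕ) :
    ∃ m, ¬ 3 ∣ m ∧ nonzeroTernaryDigits (2 * m) = r + 2 ∧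
      2 * nonzeroTernaryDigits (m ^ 2) = 8 + 4 * r + r * (r + 1) := by
  induction r with
  | zero => exact ⟨14, by norm_num, by simp [nonzeroTernaryDigits], by simp [nonzeroTernaryDigits]⟩
  | succ r ih =>
    obtain ⟨m, hm, hdouble, hsq⟩ := ih
    obtain ⟨m', -, hm', hdouble', hsq'⟩ := exists_gt_nonzeroTernaryDigits m 0 hm
    exact ⟨m', hm', by lia, by rw [hsq', hdouble]; linarith⟩

theorem infinitely_many_squares_base_three_triangular_form
    (k : ℕ) (hk : 7 ≤ k)
    (hform : ∃ p : ℕ, 0 < p ∧ k = p * (p - 1) / 2 + 1) :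
    {n : ℕ | ¬ (3 : ℕ) ∣ n ∧ (∃ m : ℕ, n = m ^ 2) ∧
      ((Nat.digits 3 n).filter (· ≠ 0)).length = k}.Infinite := by
  obtain ⟨p, -, rfl⟩ := hform
  have hp : 4 ≤ p := by
    by_contra! h
    interval_cases p <;> simp at hk
  obtain ⟨r, rfl⟩ := Nat.exists_eq_add_of_le' hp
  obtain ⟨m, hm, hdouble, hsq⟩ := exists_nonzeroTernaryDigits_sq r
  refine Set.infinite_of_forall_exists_gt fun B => ?_
  obtain ⟨m', hB, hm', -, hsq'⟩ := exists_gt_nonzeroTernaryDigits m B hm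
  refine ⟨m' ^ 2, ⟨fun h => hm' (Nat.prime_three.dvd_of_dvd_pow h), ⟨m', rfl⟩, ?_⟩,
    hB.trans_le (Nat.le_self_pow two_ne_zero m')⟩
  change nonzeroTernaryDigits (m' ^ 2) = _
  have hprod : (r + 4) * (r + 4 - 1) = r * (r + 1) + 6 * r + 12 := by
    rw [show r + 4 - 1 = r + 3 by lia]
    ring
  lia
end

section
/- For every integer a ≥ 3, the perfect square (1 + 3^a + 3^{a+1} + 3^{a+2})² has exactly 7 non-zero digits in its base-3 representation. -/
/-- The least significant digit contributes to the number of non-zero digits iff it is non-zero. -/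
theorem length_filter_digits_add_mul {x r : ℕ} (hx : 1 < x) (hr : r < x) (n : ℕ) :
    ((Nat.digits x (r + x * n)).filter (· ≠ 0)).length =
      (if r = 0 then 0 else 1) + ((Nat.digits x n).filter (· ≠ 0)).length := by
  by_cases h : r = 0 ∧ n = 0
  · simp [h.1, h.2]
  · rw [Nat.digits_add x hx r n hr (by tauto)]
    by_cases h0 : r = 0 <;> simp [h0, add_comm]

/-- Multiplying by a power of the base does not change the number of non-zero digits. -/
theorem length_filter_digits_pow_mul {x : ℕ} (hx : 1 < x) (k n : ℕ) :
    ((Nat.digits x (x ^ k * n)).filter (· ≠ 0)).length =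
      ((Nat.digits x n).filter (· ≠ 0)).length := by
  induction k with
  | zero => simp
  | succ k ih =>
    have h := length_filter_digits_add_mul hx (zero_lt_one.trans hx) (x ^ k * n)
    rw [zero_add, if_pos rfl, zero_add, ih] at h
    rw [pow_succ', mul_assoc, h]

theorem square_of_four_term_sum_base_three
    (a : ℕ) (ha : 3 ≤ a) :
    ((Nat.digits 3 ((1 + 3 ^ a + 3 ^ (a + 1) + 3 ^ (a + 2)) ^ 2)).filter
      (· ≠ 0)).length = 7 := by
  obtain ⟨c, rfl⟩ := Nat.exists_eq_add_of_le' ha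
  have h : (1 + 3 ^ (c + 3) + 3 ^ (c + 3 + 1) + 3 ^ (c + 3 + 2)) ^ 2 =
      1 + 3 * (3 ^ (c + 2) * (2 + 3 * (2 + 3 * (2 + 3 * (3 ^ c * 169))))) := by
    ring
  have h169 : ((Nat.digits 3 169).filter (· ≠ 0)).length = 3 := by
    norm_num
  have h3 : 1 < 3 := by norm_num
  rw [h, length_filter_digits_add_mul h3 (by norm_num), length_filter_digits_pow_mul h3,
    length_filter_digits_add_mul h3 (by norm_num), length_filter_digits_add_mul h3 (by norm_num),
    length_filter_digits_add_mul h3 (by norm_num), length_filter_digits_pow_mul h3, h169]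
  norm_num
end

section
/- For every integer a ≥ 4, the perfect square (1 + 3^a + 3^{a+1} + 3^{2a} + 3^{2a+1})² has exactly 11 non-zero digits in its base-3 representation. -/
theorem length_filter_digits_add_base_mul {b : ℕ} (hb : 1 < b) {r : ℕ} (hr : r < b) (n : ℕ) :
    ((Nat.digits b (r + b * n)).filter (· ≠ 0)).length =
      (if r = 0 then 0 else 1) + ((Nat.digits b n).filter (· ≠ 0)).length := by
  by_cases h : r = 0 ∧ n = 0
  · simp [h.1, h.2]
  · rw [Nat.digits_add b hb r n hr (by tauto)]
    by_cases h0 : r = 0 <;> simp [h0, add_comm]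

theorem length_filter_digits_add_base_pow_mul {b : ℕ} (hb : 1 < b) (k m n : ℕ) (hm : m < b ^ k) :
    ((Nat.digits b (m + b ^ k * n)).filter (· ≠ 0)).length =
      ((Nat.digits b m).filter (· ≠ 0)).length + ((Nat.digits b n).filter (· ≠ 0)).length := by
  induction k generalizing m with
  | zero =>
    obtain rfl : m = 0 := by simpa using hm
    simp
  | succ k ih =>
    have hr : m % b < b := Nat.mod_lt _ (by lia)
    have hq : m / b < b ^ k := Nat.div_lt_of_lt_mul (by rwa [pow_succ'] at hm)
    have hsplit : m + b ^ (k + 1) * n = m % b + b * (m / b + b ^ k * n) := by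
      conv_lhs => rw [← Nat.mod_add_div m b]
      ring
    have hdigits := length_filter_digits_add_base_mul hb hr (m / b)
    rw [Nat.mod_add_div] at hdigits
    rw [hsplit, length_filter_digits_add_base_mul hb hr, ih _ hq, hdigits, add_assoc]

theorem square_of_five_term_sum_base_three
    (a : ℕ) (ha : 4 ≤ a) :
    ((Nat.digits 3 ((1 + 3 ^ a + 3 ^ (a + 1) + 3 ^ (2 * a) + 3 ^ (2 * a + 1)) ^ 2)).filter
      (· ≠ 0)).length = 11 := by
  have hx : 3 ^ 4 ≤ 3 ^ a := Nat.pow_le_pow_right (by norm_num) ha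
  have hexpand : (1 + 3 ^ a + 3 ^ (a + 1) + 3 ^ (2 * a) + 3 ^ (2 * a + 1)) ^ 2 =
      1 + 3 ^ a * (8 + 3 ^ a * (24 + 3 ^ a * (32 + 3 ^ a * 16))) := by
    ring
  have hb : 1 < 3 := by norm_num
  rw [hexpand, length_filter_digits_add_base_pow_mul hb _ _ _ (by lia),
    length_filter_digits_add_base_pow_mul hb _ _ _ (by lia),
    length_filter_digits_add_base_pow_mul hb _ _ _ (by lia),
    length_filter_digits_add_base_pow_mul hb _ _ _ (by lia)]
  norm_num
end

section
/- Let k ≥ 4 be an integer of the form p(p−1)/2 + 1 for some positive integer p. Then there are infinitely many perfect squares not divisible by 4 having exactly k non-zero digits in their base-4 representation. -/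
/-- The number of non-zero digits of `n` in base four. -/
def baseFourWeight (n : ℕ) : ℕ := ((Nat.digits 4 n).filter (· ≠ 0)).length

lemma baseFourWeight_add_mul (d q : ℕ) (hd : d < 4) :
    baseFourWeight (d + 4 * q) = (if d = 0 then 0 else 1) + baseFourWeight q := by
  unfold baseFourWeight
  by_cases h : d ≠ 0 ∨ q ≠ 0
  · rw [Nat.digits_add 4 (by norm_num) d q hd h]
    by_cases hd0 : d = 0
    · simp [hd0]
    · simp [hd0, add_comm]
  · push Not at h
    simp [h.1, h.2]

/-- Weights add up when the two summands occupy disjoint blocks of digits. -/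
lemma baseFourWeight_add_pow_mul (t a b : ℕ) (ha : a < 4 ^ t) :
    baseFourWeight (a + 4 ^ t * b) = baseFourWeight a + baseFourWeight b := by
  induction t generalizing a with
  | zero =>
    obtain rfl : a = 0 := by simpa using ha
    simp [baseFourWeight]
  | succ t ih =>
    have hlt : a / 4 < 4 ^ t := Nat.div_lt_of_lt_mul (by rwa [pow_succ'] at ha)
    have hmod : a % 4 < 4 := Nat.mod_lt _ (by norm_num)
    have hsplit : a + 4 ^ (t + 1) * b = a % 4 + 4 * (a / 4 + 4 ^ t * b) := by
      rw [pow_succ', mul_add, ← add_assoc, Nat.mod_add_div, mul_assoc]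
    have ha' := baseFourWeight_add_mul (a % 4) (a / 4) hmod
    rw [Nat.mod_add_div] at ha'
    rw [hsplit, baseFourWeight_add_mul _ _ hmod, ih _ hlt, ha', add_assoc]

lemma baseFourWeight_one : baseFourWeight 1 = 1 := by simp [baseFourWeight]

lemma baseFourWeight_two : baseFourWeight 2 = 1 := by simp [baseFourWeight]

/-- The weight of `m + 2 * 4 ^ t` when `t` is large compared with `m`. -/
lemma baseFourWeight_add_two_mul_pow (m t : ℕ) (h : m ^ 2 < 4 ^ t) :
    baseFourWeight (m + 4 ^ t * 2) = baseFourWeight m + 1 := by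
  rw [baseFourWeight_add_pow_mul _ _ _ (by nlinarith), baseFourWeight_two]

/-- The weight of the square of `m + 2 * 4 ^ t` when `t` is large compared with `m`. -/
lemma baseFourWeight_sq_add_two_mul_pow (m t : ℕ) (h : m ^ 2 < 4 ^ t) :
    baseFourWeight ((m + 4 ^ t * 2) ^ 2) = baseFourWeight (m ^ 2) + baseFourWeight m + 1 := by
  have hsq : (m + 4 ^ t * 2) ^ 2 = m ^ 2 + 4 ^ (t + 1) * (m + 4 ^ t * 1) := by ring
  rw [hsq, baseFourWeight_add_pow_mul _ _ _ (by rw [pow_succ 4 t]; omega),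
    baseFourWeight_add_pow_mul _ _ _ (by nlinarith), baseFourWeight_one, add_assoc]

lemma exists_odd_baseFourWeight_sq (r : ℕ) :
    ∃ m : ℕ, Odd m ∧ baseFourWeight m = r + 1 ∧
      baseFourWeight (m ^ 2) = (r + 2).choose 2 + 1 := by
  induction r with
  | zero => exact ⟨3, by decide, by simp [baseFourWeight], by simp [baseFourWeight]⟩
  | succ r ih =>
    obtain ⟨m, hodd, hm, hsq⟩ := ih
    have h : m ^ 2 < 4 ^ (m ^ 2) := Nat.lt_pow_self (by norm_num)
    refine ⟨m + 4 ^ (m ^ 2) * 2, hodd.add_even (even_two.mul_left _), ?_, ?_⟩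
    · rw [baseFourWeight_add_two_mul_pow _ _ h, hm]
    · rw [baseFourWeight_sq_add_two_mul_pow _ _ h, hm, hsq, Nat.choose_succ_succ' (r + 2) 1,
        Nat.choose_one_right, one_add_one_eq_two]
      omega

theorem infinitely_many_squares_base_four_triangular_form
    (k : ℕ) (hk : 4 ≤ k)
    (hform : ∃ p : ℕ, 0 < p ∧ k = p * (p - 1) / 2 + 1) :
    {n : ℕ | ¬ (4 : ℕ) ∣ n ∧ (∃ m : ℕ, n = m ^ 2) ∧
      ((Nat.digits 4 n).filter (· ≠ 0)).length = k}.Infinite := by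
  obtain ⟨p, -, rfl⟩ := hform
  rw [← Nat.choose_two_right] at hk ⊢
  have hp : 3 ≤ p := by
    by_contra! hlt
    interval_cases p <;> simp at hk
  obtain ⟨r, rfl⟩ := Nat.exists_eq_add_of_le' hp
  obtain ⟨m, hodd, hm, hsq⟩ := exists_odd_baseFourWeight_sq r
  rw [Set.infinite_iff_exists_gt]
  intro N
  have hlt : m ^ 2 + N < 4 ^ (m ^ 2 + N) := Nat.lt_pow_self (by norm_num)
  set t := m ^ 2 + N
  have ht : m ^ 2 < 4 ^ t := by omega
  refine ⟨(m + 4 ^ t * 2) ^ 2, ⟨fun hdvd => ?_, ⟨_, rfl⟩, ?_⟩, ?_⟩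
  · have hodd' : Odd ((m + 4 ^ t * 2) ^ 2) := (hodd.add_even (even_two.mul_left _)).pow
    obtain ⟨c, hc⟩ := hodd'
    omega
  · change baseFourWeight _ = _
    rw [baseFourWeight_sq_add_two_mul_pow _ _ ht, hm, hsq, Nat.choose_succ_succ' (r + 2) 1,
      Nat.choose_one_right, one_add_one_eq_two]
    omega
  · have hN : N < m + 4 ^ t * 2 := by omega
    nlinarith
end

section
/- Let p ≥ 3 be an integer and let α₀ = 0 < α₁ < … < α_{p−2} be integers with α₁ ≥ 2 and α_i > 2α_{i−1} for all i with 2 ≤ i ≤ p − 2. Set y = 3·4^{α_{p−2}} + 2·(4^{α₀} + 4^{α₁} + … + 4^{α_{p−3}}). Then y² has exactly p(p−1)/2 + 1 non-zero digits in its base-4 representation. -/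
/-- The number of non-zero digits of `n` in base `4`. -/
def nonzeroDigitCountFour (n : ℕ) : ℕ := ((Nat.digits 4 n).filter (· ≠ 0)).length

lemma nonzeroDigitCountFour_add_four_mul {r : ℕ} (hr : r < 4) (n : ℕ) :
    nonzeroDigitCountFour (r + 4 * n) = nonzeroDigitCountFour n + if r = 0 then 0 else 1 := by
  unfold nonzeroDigitCountFour
  by_cases h : r = 0
  · subst h
    rcases Nat.eq_zero_or_pos n with rfl | hn
    · simp
    · rw [Nat.digits_add 4 (by norm_num) 0 n hr (Or.inr hn.ne')]
      simp
  · rw [Nat.digits_add 4 (by norm_num) r n hr (Or.inl h)]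
    simp [h]

lemma nonzeroDigitCountFour_four_mul (n : ℕ) :
    nonzeroDigitCountFour (4 * n) = nonzeroDigitCountFour n := by
  simpa using nonzeroDigitCountFour_add_four_mul (r := 0) (by norm_num) n

lemma nonzeroDigitCountFour_of_pos_of_lt {r : ℕ} (h0 : 0 < r) (hr : r < 4) :
    nonzeroDigitCountFour r = 1 := by
  have h := nonzeroDigitCountFour_add_four_mul hr 0
  simpa [h0.ne', nonzeroDigitCountFour] using h

lemma nonzeroDigitCountFour_nine : nonzeroDigitCountFour 9 = 2 := by
  simp [nonzeroDigitCountFour]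

/-- Digit counts add up when two blocks of digits do not overlap. -/
lemma nonzeroDigitCountFour_add_pow_mul (n a b : ℕ) (ha : a < 4 ^ n) :
    nonzeroDigitCountFour (a + 4 ^ n * b) =
      nonzeroDigitCountFour a + nonzeroDigitCountFour b := by
  induction n generalizing a with
  | zero =>
    obtain rfl : a = 0 := by simpa using ha
    simp [nonzeroDigitCountFour]
  | succ n ih =>
    have hr : a % 4 < 4 := Nat.mod_lt _ (by norm_num)
    have hq : a / 4 < 4 ^ n := by rw [pow_succ] at ha; omega
    have h1 : a + 4 ^ (n + 1) * b = a % 4 + 4 * (a / 4 + 4 ^ n * b) := by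
      conv_lhs => rw [← Nat.mod_add_div a 4]
      ring
    have h2 := nonzeroDigitCountFour_add_four_mul hr (a / 4)
    rw [Nat.mod_add_div] at h2
    rw [h1, nonzeroDigitCountFour_add_four_mul hr, ih _ hq, h2]
    ring

/-- Size bounds and digit counts for the sums of powers of `4` with rapidly growing exponents. -/
lemma sum_four_pow_bounds_and_digit_counts (m : ℕ) (α : ℕ → ℕ) (hα0 : α 0 = 0)
    (hα1 : 2 ≤ α 1) (hgt : ∀ i, 2 ≤ i → i ≤ m → α i > 2 * α (i - 1))
    (k : ℕ) (hk : 1 ≤ k) (hkm : k ≤ m) :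
    12 * ∑ i ∈ Finset.range k, 4 ^ α i < 4 ^ α k ∧
    (∑ i ∈ Finset.range k, 4 ^ α i) ^ 2 < 4 ^ α k ∧
    nonzeroDigitCountFour (2 * ∑ i ∈ Finset.range k, 4 ^ α i) = k ∧
    nonzeroDigitCountFour (3 * ∑ i ∈ Finset.range k, 4 ^ α i) = k ∧
    2 * nonzeroDigitCountFour ((∑ i ∈ Finset.range k, 4 ^ α i) ^ 2) = k * (k + 1) := by
  induction k, hk using Nat.le_induction with
  | base =>
    have h16 : 4 ^ 2 ≤ 4 ^ α 1 := Nat.pow_le_pow_right (by norm_num) hα1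
    have hc {r : ℕ} (h0 : 0 < r) (hr : r < 4) := nonzeroDigitCountFour_of_pos_of_lt h0 hr
    simp only [Finset.sum_range_one, hα0, pow_zero, mul_one, one_pow]
    refine ⟨by omega, by omega, hc ?_ ?_, hc ?_ ?_, ?_⟩ <;> try norm_num
    rw [hc] <;> norm_num
  | succ k hk ih =>
    obtain ⟨h12, hsq, hc2, hc3, hcsq⟩ := ih (by omega)
    rw [Finset.sum_range_succ]
    set S := ∑ i ∈ Finset.range k, 4 ^ α i
    have hα : 2 * α k + 1 ≤ α (k + 1) := hgt (k + 1) (by omega) hkm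
    have hA : 4 * (4 ^ α k) ^ 2 ≤ 4 ^ α (k + 1) := by
      calc 4 * (4 ^ α k) ^ 2 = 4 ^ (2 * α k + 1) := by ring
        _ ≤ _ := Nat.pow_le_pow_right (by norm_num) hα
    have hS : 0 < S :=
      Finset.sum_pos (fun _ _ => by positivity) (Finset.nonempty_range_iff.mpr (by omega))
    have hone {r : ℕ} (h0 : 0 < r) (hr : r < 4) := nonzeroDigitCountFour_of_pos_of_lt h0 hr
    have hsum (r : ℕ) : r * (S + 4 ^ α k) = r * S + 4 ^ α k * r := by ring
    have hexp : (S + 4 ^ α k) ^ 2 = S ^ 2 + 4 ^ α k * (2 * S + 4 ^ α k * 1) := by ring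
    refine ⟨by nlinarith, by nlinarith, ?_, ?_, ?_⟩
    · rw [hsum, nonzeroDigitCountFour_add_pow_mul _ _ _ (by omega), hc2,
        hone (by norm_num) (by norm_num)]
    · rw [hsum, nonzeroDigitCountFour_add_pow_mul _ _ _ (by omega), hc3,
        hone (by norm_num) (by norm_num)]
    · rw [hexp, nonzeroDigitCountFour_add_pow_mul _ _ _ hsq,
        nonzeroDigitCountFour_add_pow_mul _ _ _ (by omega), hc2,
        hone (r := 1) (by norm_num) (by norm_num), mul_add, hcsq]
      ring

theorem base_four_digit_count_special_construction
    (p : ℕ) (hp : 3 ≤ p)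
    (α : ℕ → ℕ) (hα0 : α 0 = 0) (hα1 : 2 ≤ α 1)
    (hmono : ∀ i, i + 1 ≤ p - 2 → α i < α (i + 1))
    (hgt : ∀ i, 2 ≤ i → i ≤ p - 2 → α i > 2 * α (i - 1)) :
    ((Nat.digits 4
      ((3 * 4 ^ α (p - 2) + 2 * ∑ i ∈ Finset.range (p - 2), 4 ^ α i) ^ 2)).filter
        (· ≠ 0)).length = p * (p - 1) / 2 + 1 := by
  obtain ⟨m, rfl⟩ : ∃ m, p = m + 2 := ⟨p - 2, by omega⟩
  rw [Nat.add_sub_cancel] at *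
  change nonzeroDigitCountFour _ = _
  obtain ⟨h12, hsq, -, hc3, hcsq⟩ :=
    sum_four_pow_bounds_and_digit_counts m α hα0 hα1 hgt m (by omega) le_rfl
  set S := ∑ i ∈ Finset.range m, 4 ^ α i
  obtain ⟨b, hb⟩ : ∃ b, α m = b + 1 := by
    obtain ⟨n, rfl⟩ : ∃ n, m = n + 1 := ⟨m - 1, by omega⟩
    have := hmono n le_rfl
    exact ⟨α (n + 1) - 1, by omega⟩
  have hpow : 4 ^ α m = 4 * 4 ^ b := by rw [hb]; ring
  have hexp : (3 * 4 ^ α m + 2 * S) ^ 2 =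
      4 * (S ^ 2 + 4 ^ α m * (3 * S + 4 ^ b * 9)) := by
    rw [hpow]; ring
  rw [hexp, nonzeroDigitCountFour_four_mul, nonzeroDigitCountFour_add_pow_mul _ _ _ hsq,
    nonzeroDigitCountFour_add_pow_mul _ _ _ (by omega), hc3, nonzeroDigitCountFour_nine]
  have h : (m + 2) * (m + 2 - 1) = m * (m + 1) + 2 * (m + 1) := by
    rw [show m + 2 - 1 = m + 1 by omega]; ring
  omega
end
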